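/- arXiv:1901.08371 — 2 statements merged into one kernel-verified Lean document; each statement's English description precedes it below -/
import Mathlib

section
/- Let q be a prime, G a commutative group of order q, and h ∈ G. Suppose ĉ₀, ĉ₁, …, ĉ_N ∈ G, t̂_1,…,t̂_N ∈ G, and c, c* ∈ ZMod q, ŝ, ŝ*, s', s'* ∈ (ZMod q)^N satisfy c ≠ c*, t̂_i = ĉ_i^{-c} h^{ŝ_i} ĉ_{i-1}^{s'_i} and t̂_i = ĉ_i^{-c*} h^{ŝ^*_i} ĉ_{i-1}^{s'^*_i} for all i ∈ {1,…,N}. Then for every i, ĉ_i = h^{r̂_i} ĉ_{i-1}^{u'_i} where r̂_i = (ŝ_i-ŝ^*_i)/(c-c*) and u'_i = (s'_i-s'^*_i)/(c-c*); that is, ĉ_i = PC_{h,ĉ_{i-1}}(u'_i, r̂_i). -/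
/-- Exponentiation of a monoid element by an element of `ZMod n`. -/
instance (priority := low) monoidZModPow {M : Type*} [Monoid M] {n : ℕ} :
    Pow M (ZMod n) := ⟨fun g x => g ^ x.val⟩

/-- The Pedersen commitment with bases `h` and `b`: `PC(m, r) = h^r b^m`. -/
def PC {G : Type*} [CommGroup G] {q : ℕ} (h b : G) (m r : ZMod q) : G :=
  h ^ r * b ^ m

lemma zmod_pow_def {M : Type*} [Monoid M] {n : ℕ} (g : M) (x : ZMod n) : g ^ x = g ^ x.val :=
  rfl

lemma zmod_pow_add {M : Type*} [Monoid M] {n : ℕ} [NeZero n] {g : M} (hg : g ^ n = 1)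
    (x y : ZMod n) : g ^ (x + y) = g ^ x * g ^ y := by
  simp only [zmod_pow_def, ← pow_add, ZMod.val_add]
  exact (pow_eq_pow_mod _ hg).symm

lemma zmod_pow_mul {M : Type*} [Monoid M] {n : ℕ} {g : M} (hg : g ^ n = 1)
    (x y : ZMod n) : g ^ (x * y) = (g ^ x) ^ y := by
  simp only [zmod_pow_def, ← pow_mul, ZMod.val_mul]
  exact (pow_eq_pow_mod _ hg).symm

lemma mul_zmod_pow {M : Type*} [CommMonoid M] {n : ℕ} (a b : M) (x : ZMod n) :
    (a * b) ^ x = a ^ x * b ^ x :=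
  mul_pow a b x.val

lemma zmod_pow_sub {M : Type*} [Group M] {n : ℕ} [NeZero n] {g : M} (hg : g ^ n = 1)
    (x y : ZMod n) : g ^ (x - y) = g ^ x / g ^ y := by
  rw [eq_div_iff_mul_eq', ← zmod_pow_add hg, sub_add_cancel]

lemma zmod_pow_one {M : Type*} [Monoid M] {n : ℕ} [Fact (1 < n)] (g : M) :
    g ^ (1 : ZMod n) = g := by
  rw [zmod_pow_def, ZMod.val_one, pow_one]

theorem stmt_10 {q : ℕ} [Fact (Nat.Prime q)] {G : Type*} [CommGroup G] [Fintype G]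
    (hcard : Fintype.card G = q) (h : G) (N : ℕ)
    (chat that : ℕ → G) (c cstar : ZMod q)
    (shat shatstar s' s'star : ℕ → ZMod q)
    (hne : c ≠ cstar)
    (h1 : ∀ i, 1 ≤ i → i ≤ N →
      that i = chat i ^ (-c) * h ^ shat i * chat (i - 1) ^ s' i)
    (h2 : ∀ i, 1 ≤ i → i ≤ N →
      that i = chat i ^ (-cstar) * h ^ shatstar i * chat (i - 1) ^ s'star i) :
    ∀ i, 1 ≤ i → i ≤ N →
      chat i = PC h (chat (i - 1)) ((s' i - s'star i) / (c - cstar))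
        ((shat i - shatstar i) / (c - cstar)) := by
  intro i hi hiN
  have : Fact (1 < q) := ⟨(Fact.out : q.Prime).one_lt⟩
  have hpow (g : G) : g ^ q = 1 := hcard ▸ pow_card_eq_one
  have hd : c - cstar ≠ 0 := sub_ne_zero.mpr hne
  have key : chat i ^ (c - cstar) =
      h ^ (shat i - shatstar i) * chat (i - 1) ^ (s' i - s'star i) := by
    have heq := (h1 i hi hiN).symm.trans (h2 i hi hiN)
    rw [show c - cstar = -cstar - -c by ring]
    simp only [zmod_pow_sub (hpow _)]
    rw [div_mul_div_comm, div_eq_div_iff_mul_eq_mul, ← mul_assoc, ← heq]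
    ac_rfl
  unfold PC
  rw [div_eq_mul_inv, div_eq_mul_inv, zmod_pow_mul (hpow _), zmod_pow_mul (hpow _),
    ← mul_zmod_pow, ← key, ← zmod_pow_mul (hpow _), mul_inv_cancel₀ hd, zmod_pow_one]
end

section
/- Let q be a prime, G a commutative group of order q, and h, h₁, …, h_N ∈ G. Let U ∈ (ZMod q)^{N×N} be invertible with inverse A (so UA = AU = I), let c ∈ G^N, U' ∈ (ZMod q)^{N×N} and r̃ ∈ (ZMod q)^N, and suppose that for every j, ∏_{i=1}^N c_i^{U_{i,j}} = EPC(U'_j, r̃_j), where U'_j is the j-th column of U'. Then for every l, c_l = EPC(Σ_{j=1}^N A_{j,l} U'_j, ⟨r̃, A_l⟩); that is, c is the matrix commitment to M = U'A with randomness vector r̃A. -/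
/-- The extended Pedersen commitment `EPC(m, r) = h^r ∏ i, hᵢ^(mᵢ)`. -/
def EPC {G : Type*} [CommGroup G] {q N : ℕ} (h : G) (hs : Fin N → G)
    (m : Fin N → ZMod q) (r : ZMod q) : G :=
  h ^ r * ∏ i, hs i ^ m i

section ZModPow

variable {G : Type*} [CommGroup G] {q : ℕ}

theorem pow_zmod_def (g : G) (x : ZMod q) : g ^ x = g ^ x.val := rfl

theorem pow_zmod_natCast (hG : ∀ g : G, g ^ q = 1) (g : G) (k : ℕ) :
    g ^ (k : ZMod q) = g ^ k := by
  rw [pow_zmod_def, ZMod.val_natCast]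
  exact (pow_eq_pow_mod k (hG g)).symm

theorem pow_zmod_zero (g : G) : g ^ (0 : ZMod q) = 1 := by
  rw [pow_zmod_def, ZMod.val_zero, pow_zero]

theorem mul_pow_zmod (g g' : G) (x : ZMod q) : (g * g') ^ x = g ^ x * g' ^ x :=
  mul_pow g g' x.val

theorem prod_pow_zmod {ι : Type*} (s : Finset ι) (f : ι → G) (x : ZMod q) :
    (∏ i ∈ s, f i) ^ x = ∏ i ∈ s, f i ^ x :=
  (Finset.prod_pow s x.val f).symm

theorem pow_zmod_one (hG : ∀ g : G, g ^ q = 1) (g : G) : g ^ (1 : ZMod q) = g := by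
  rw [← Nat.cast_one, pow_zmod_natCast hG, pow_one]

variable [NeZero q]

theorem pow_zmod_add (hG : ∀ g : G, g ^ q = 1) (g : G) (x y : ZMod q) :
    g ^ (x + y) = g ^ x * g ^ y := by
  rw [← ZMod.natCast_zmod_val x, ← ZMod.natCast_zmod_val y, ← Nat.cast_add]
  simp only [pow_zmod_natCast hG, pow_add]

theorem pow_zmod_mul (hG : ∀ g : G, g ^ q = 1) (g : G) (x y : ZMod q) :
    g ^ (x * y) = (g ^ x) ^ y := by
  rw [← ZMod.natCast_zmod_val x, ← ZMod.natCast_zmod_val y, ← Nat.cast_mul]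
  simp only [pow_zmod_natCast hG, pow_mul]

theorem pow_zmod_sum (hG : ∀ g : G, g ^ q = 1) {ι : Type*} (s : Finset ι) (g : G)
    (f : ι → ZMod q) : g ^ (∑ i ∈ s, f i) = ∏ i ∈ s, g ^ f i := by
  classical
  induction s using Finset.induction_on with
  | empty => simp [pow_zmod_zero]
  | insert a s ha ih => rw [Finset.sum_insert ha, Finset.prod_insert ha, pow_zmod_add hG, ih]

/-- The extended Pedersen commitment is linear in the message and the randomness. -/
theorem EPC_sum_mul (hG : ∀ g : G, g ^ q = 1) {N : ℕ} (h : G) (hs : Fin N → G)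
    {ι : Type*} (s : Finset ι) (m : ι → Fin N → ZMod q) (r a : ι → ZMod q) :
    EPC h hs (fun i => ∑ j ∈ s, m j i * a j) (∑ j ∈ s, r j * a j) =
      ∏ j ∈ s, EPC h hs (m j) (r j) ^ a j := by
  simp only [EPC, pow_zmod_sum hG, pow_zmod_mul hG, mul_pow_zmod, prod_pow_zmod,
    Finset.prod_mul_distrib]
  rw [Finset.prod_comm]

/-- Exponentiating a vector of group elements by `U` and then by a right inverse of `U`
recovers the vector. -/
theorem prod_prod_pow_zmod_of_mul_eq_one (hG : ∀ g : G, g ^ q = 1) {ι : Type*} [Fintype ι]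
    [DecidableEq ι] {U A : Matrix ι ι (ZMod q)} (hUA : U * A = 1) (c : ι → G) (l : ι) :
    ∏ j, (∏ i, c i ^ U i j) ^ A j l = c l := by
  simp only [prod_pow_zmod, ← pow_zmod_mul hG]
  rw [Finset.prod_comm]
  simp only [← pow_zmod_sum hG, ← Matrix.mul_apply, hUA]
  rw [Finset.prod_eq_single l]
  · rw [Matrix.one_apply_eq, pow_zmod_one hG]
  · intro i _ hi
    rw [Matrix.one_apply_ne hi, pow_zmod_zero]
  · simp

end ZModPow

theorem stmt_12 {q : ℕ} [Fact (Nat.Prime q)] {G : Type*} [CommGroup G] [Fintype G]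
    (hcard : Fintype.card G = q) {N : ℕ} (h : G) (hs : Fin N → G)
    (U A : Matrix (Fin N) (Fin N) (ZMod q)) (hUA : U * A = 1) (hAU : A * U = 1)
    (cvec : Fin N → G) (U' : Matrix (Fin N) (Fin N) (ZMod q)) (rt : Fin N → ZMod q)
    (hopen : ∀ j, ∏ i, cvec i ^ U i j = EPC h hs (fun i => U' i j) (rt j)) :
    ∀ l, cvec l = EPC h hs (fun i => ∑ j, A j l * U' i j) (∑ j, rt j * A j l) := by
  have hG : ∀ g : G, g ^ q = 1 := fun g => hcard ▸ pow_card_eq_one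
  intro l
  rw [← prod_prod_pow_zmod_of_mul_eq_one hG hUA cvec l]
  simp only [hopen, mul_comm (A _ l)]
  exact (EPC_sum_mul hG h hs Finset.univ (fun j i => U' i j) rt (fun j => A j l)).symm
end
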